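/- In addition to the hypotheses of the gradient lower bound (identities (i) and (ii) for (λ, u) with mass c, the bounds G(s) ≤ C₂·|s|^d, ‖Ṽ₊‖_{N/2} < 2S, the Sobolev inequality for u, and the Gagliardo–Nirenberg constant C_{N,d}), assume also that V and Ṽ are bounded, with sup norms ‖V‖_∞ and ‖Ṽ‖_∞. Then there exists c̃ > 0, depending only on N, β, d, C₂, C_{N,d}, S, ‖Ṽ₊‖_{N/2}, ‖V‖_∞ and ‖Ṽ‖_∞, such that whenever 0 < c < c̃ one has λ > 0. -/

import Mathlib

open MeasureTheory

/-- If `θ * A ≤ D * c ^ p * A ^ q` with `p + q > 1`, then `A / c` exceeds any prescribed bound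
for all sufficiently small `c > 0`. -/
lemma exists_threshold_forall_mul_lt {θ D p q m : ℝ} (hθ : 0 < θ) (hD : 0 ≤ D) (hp : 0 < p)
    (hq : 1 < q) (hm : 0 ≤ m) :
    ∃ ctilde > (0 : ℝ), ∀ c A : ℝ, 0 < c → c < ctilde → 0 < A →
      θ * A ≤ D * c ^ p * A ^ q → m * c < A := by
  have hr : 0 < p + (q - 1) := by linarith
  have hE : 0 < D * m ^ (q - 1) + 1 := by positivity
  refine ⟨(θ / (D * m ^ (q - 1) + 1)) ^ (p + (q - 1))⁻¹, by positivity, ?_⟩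
  intro c A hc hcc hA h
  by_contra! hle
  have h1 : c ^ (p + (q - 1)) < θ / (D * m ^ (q - 1) + 1) := by
    have h := Real.rpow_lt_rpow hc.le hcc hr
    rwa [← Real.rpow_mul (by positivity), inv_mul_cancel₀ hr.ne', Real.rpow_one] at h
  have h2 : θ ≤ D * c ^ p * A ^ (q - 1) := by
    have hAq : A ^ q = A ^ (q - 1) * A := by
      rw [← Real.rpow_add_one hA.ne']; ring_nf
    rw [hAq, ← mul_assoc] at h
    exact le_of_mul_le_mul_right h hA
  have h3 : A ^ (q - 1) ≤ m ^ (q - 1) * c ^ (q - 1) := by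
    rw [← Real.mul_rpow hm hc.le]
    exact Real.rpow_le_rpow hA.le hle (by linarith)
  have h4 : θ ≤ D * m ^ (q - 1) * c ^ (p + (q - 1)) := by
    rw [Real.rpow_add hc]
    calc θ ≤ D * c ^ p * A ^ (q - 1) := h2
      _ ≤ D * c ^ p * (m ^ (q - 1) * c ^ (q - 1)) := by gcongr
      _ = _ := by ring
  rw [lt_div_iff₀ hE] at h1
  have h5 : 0 < c ^ (p + (q - 1)) := by positivity
  linarith

/-- Interpolation: a continuous function in `L²` and `L^q` has integrable `d`-th power for
`2 ≤ d ≤ q`. -/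
lemma integrable_abs_rpow_of_le_of_le {X : Type*} [TopologicalSpace X] [MeasurableSpace X]
    [OpensMeasurableSpace X] {μ : Measure X} {u : X → ℝ} (hu : Continuous u) {d q : ℝ}
    (hd : 2 ≤ d) (hdq : d ≤ q) (h2 : Integrable (fun x => |u x| ^ 2) μ)
    (hq : Integrable (fun x => |u x| ^ q) μ) : Integrable (fun x => |u x| ^ d) μ := by
  refine (h2.add hq).mono'
    ((hu.abs.rpow_const fun _ => Or.inr (by linarith)).measurable.aestronglyMeasurable) ?_
  refine Filter.Eventually.of_forall fun x => ?_
  have h0 : 0 ≤ |u x| := abs_nonneg _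
  rw [Real.norm_of_nonneg (by positivity)]
  simp only [Pi.add_apply]
  have hnn : 0 ≤ |u x| ^ q := by positivity
  rcases le_total |u x| 1 with h | h
  · rcases h0.eq_or_lt with h' | h'
    · rw [← h', Real.zero_rpow (by linarith), Real.zero_rpow (by linarith)]; norm_num
    · have := Real.rpow_le_rpow_of_exponent_ge h' h hd
      rw [Real.rpow_two] at this
      linarith
  · have := Real.rpow_le_rpow_of_exponent_le h hdq
    have h2nn : 0 ≤ |u x| ^ 2 := by positivity
    linarith

/-- Hölder's inequality with exponents `n / 2` and `n / (n - 2)` for a potential against `u²`. -/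
lemma integral_mul_sq_le_holder {X : Type*} [TopologicalSpace X] [MeasurableSpace X]
    [OpensMeasurableSpace X] {μ : Measure X} {f u : X → ℝ} (hf : Continuous f)
    (hu : Continuous u) {n : ℝ} (hn : 2 < n)
    (hfi : Integrable (fun x => max (f x) 0 ^ (n / 2)) μ)
    (hui : Integrable (fun x => |u x| ^ (2 * n / (n - 2))) μ)
    (hfu : Integrable (fun x => f x * u x ^ 2) μ) :
    ∫ x, f x * u x ^ 2 ∂μ ≤ (∫ x, max (f x) 0 ^ (n / 2) ∂μ) ^ (2 / n) *
      (∫ x, |u x| ^ (2 * n / (n - 2)) ∂μ) ^ ((n - 2) / n) := by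
  have hn2 : 0 < n - 2 := by linarith
  have hpq : (n / 2).HolderConjugate (n / (n - 2)) := by
    rw [Real.holderConjugate_iff]
    refine ⟨by linarith, ?_⟩
    field_simp
    ring
  have hsq : ∀ x, (u x ^ 2) ^ (n / (n - 2)) = |u x| ^ (2 * n / (n - 2)) := fun x => by
    rw [← sq_abs, ← Real.rpow_natCast, ← Real.rpow_mul (abs_nonneg _)]
    congr 1
    push_cast
    ring
  have hmf : MemLp (fun x => max (f x) 0) (ENNReal.ofReal (n / 2)) μ := by
    rw [← integrable_norm_rpow_iff (hf.max continuous_const).measurable.aestronglyMeasurable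
      (by simp; linarith) (by simp), ENNReal.toReal_ofReal (by linarith)]
    refine hfi.congr (Filter.Eventually.of_forall fun x => ?_)
    simp only
    rw [Real.norm_of_nonneg (le_max_right _ _)]
  have hmu : MemLp (fun x => u x ^ 2) (ENNReal.ofReal (n / (n - 2))) μ := by
    have hsm : AEStronglyMeasurable (fun x => u x ^ 2) μ :=
      (hu.pow 2).measurable.aestronglyMeasurable
    rw [← integrable_norm_rpow_iff hsm
      (by simp only [ne_eq, ENNReal.ofReal_eq_zero, not_le]; exact hpq.symm.pos) (by simp),
      ENNReal.toReal_ofReal hpq.symm.nonneg]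
    refine hui.congr (Filter.Eventually.of_forall fun x => ?_)
    simp only
    rw [Real.norm_of_nonneg (sq_nonneg _), hsq]
  have hint : Integrable (fun x => max (f x) 0 * u x ^ 2) μ := by
    refine hfu.norm.mono' ((hf.max continuous_const).mul
      (hu.pow 2)).measurable.aestronglyMeasurable (Filter.Eventually.of_forall fun x => ?_)
    rw [norm_mul, norm_mul]
    refine mul_le_mul_of_nonneg_right ?_ (norm_nonneg _)
    rw [Real.norm_of_nonneg (le_max_right _ _)]
    exact max_le (le_abs_self _) (abs_nonneg _)
  have hH := integral_mul_le_Lp_mul_Lq_of_nonneg hpq (μ := μ)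
    (f := fun x => max (f x) 0) (g := fun x => u x ^ 2)
    (Filter.Eventually.of_forall fun x => le_max_right _ _)
    (Filter.Eventually.of_forall fun x => sq_nonneg _) hmf hmu
  simp only [hsq, one_div_div] at hH
  refine le_trans (integral_mono hfu hint fun x => ?_) hH
  exact mul_le_mul_of_nonneg_right (le_max_left _ _) (sq_nonneg _)

/-- A bounded weight changes the `L²` mass by at most its bound. -/
lemma abs_integral_mul_sq_le {X : Type*} [MeasurableSpace X] {μ : Measure X} {f u : X → ℝ}
    {M : ℝ} (hf : ∀ x, |f x| ≤ M) (hu : Integrable (fun x => |u x| ^ 2) μ) :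
    |∫ x, f x * u x ^ 2 ∂μ| ≤ M * ∫ x, |u x| ^ 2 ∂μ := by
  rw [← integral_const_mul, ← Real.norm_eq_abs]
  refine norm_integral_le_of_norm_le (hu.const_mul M) (Filter.Eventually.of_forall fun x => ?_)
  rw [Real.norm_eq_abs, abs_mul, abs_pow]
  exact mul_le_mul_of_nonneg_right (hf x) (by positivity)

/-- there exists a mass threshold `c̃ > 0`, depending only on
`N, β, d, C₂, C_{N,d}, S, ‖Ṽ₊‖_{N/2}, ‖V‖_∞, ‖Ṽ‖_∞`, such that any normalized solution
`(λ, u)` (satisfying the hypotheses of the gradient lower bound) with mass `0 < c < c̃`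
has positive Lagrange multiplier `λ > 0`. -/
theorem stmt_14 (N : ℕ) (hN : 3 ≤ N)
    (β d C₂ CNd S nVhalf nVinf nVtinf : ℝ)
    (hβ : 2 + 4 / (N : ℝ) < β) (hβ' : β < 2 * (N : ℝ) / ((N : ℝ) - 2))
    (hd : 2 + 4 / (N : ℝ) < d) (hd' : d < 2 * (N : ℝ) / ((N : ℝ) - 2))
    (hC₂ : 0 < C₂) (hCNd : 0 < CNd) (hS : 0 < S) (hnVhalf : nVhalf < 2 * S)
    (hGN : ∀ w : EuclideanSpace ℝ (Fin N) → ℝ, ContDiff ℝ 1 w →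
      Integrable (fun x => |w x| ^ d) → Integrable (fun x => |w x| ^ 2) →
      Integrable (fun x => ‖fderiv ℝ w x‖ ^ 2) →
      (∫ x : EuclideanSpace ℝ (Fin N), |w x| ^ d) ≤
        CNd * (∫ x : EuclideanSpace ℝ (Fin N), |w x| ^ 2) ^ ((2 * d - (N : ℝ) * (d - 2)) / 4) *
          (∫ x : EuclideanSpace ℝ (Fin N), ‖fderiv ℝ w x‖ ^ 2) ^ ((N : ℝ) * (d - 2) / 4)) :
    ∃ ctilde > (0:ℝ),
      ∀ (g G : ℝ → ℝ) (α : ℝ) (V Vt : EuclideanSpace ℝ (Fin N) → ℝ)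
        (c lam : ℝ) (u : EuclideanSpace ℝ (Fin N) → ℝ),
        Continuous g → (∀ s : ℝ, g (-s) = -g s) →
        (∀ s : ℝ, G s = ∫ t in (0:ℝ)..s, g t) →
        2 + 4 / (N : ℝ) < α → α ≤ β →
        (∀ s : ℝ, s ≠ 0 → 0 < α * G s ∧ α * G s ≤ g s * s ∧ g s * s ≤ β * G s) →
        (∀ s : ℝ, G s ≤ C₂ * |s| ^ d) →
        ContDiff ℝ 1 V →
        (∀ x : EuclideanSpace ℝ (Fin N), Vt x = fderiv ℝ V x x) →
        Integrable (fun x : EuclideanSpace ℝ (Fin N) => max (Vt x) 0 ^ ((N : ℝ) / 2)) →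
        (∫ x : EuclideanSpace ℝ (Fin N), max (Vt x) 0 ^ ((N : ℝ) / 2)) ^ (2 / (N : ℝ)) = nVhalf →
        (∀ x : EuclideanSpace ℝ (Fin N), |V x| ≤ nVinf) →
        (∀ x : EuclideanSpace ℝ (Fin N), |Vt x| ≤ nVtinf) →
        ContDiff ℝ 1 u → u ≠ 0 →
        (∫ x : EuclideanSpace ℝ (Fin N), |u x| ^ 2) = c →
        Integrable (fun x : EuclideanSpace ℝ (Fin N) => |u x| ^ 2) →
        (0 < ∫ x : EuclideanSpace ℝ (Fin N), ‖fderiv ℝ u x‖ ^ 2) →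
        Integrable (fun x : EuclideanSpace ℝ (Fin N) => ‖fderiv ℝ u x‖ ^ 2) →
        Integrable (fun x : EuclideanSpace ℝ (Fin N) => |u x| ^ (2 * (N : ℝ) / ((N : ℝ) - 2))) →
        Integrable (fun x : EuclideanSpace ℝ (Fin N) => V x * u x ^ 2) →
        Integrable (fun x : EuclideanSpace ℝ (Fin N) => Vt x * u x ^ 2) →
        Integrable (fun x : EuclideanSpace ℝ (Fin N) => g (u x) * u x) →
        Integrable (fun x : EuclideanSpace ℝ (Fin N) => G (u x)) →
        (S * (∫ x : EuclideanSpace ℝ (Fin N), |u x| ^ (2 * (N : ℝ) / ((N : ℝ) - 2)))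
            ^ (((N : ℝ) - 2) / (N : ℝ)) ≤ ∫ x : EuclideanSpace ℝ (Fin N), ‖fderiv ℝ u x‖ ^ 2) →
        ((∫ x : EuclideanSpace ℝ (Fin N), ‖fderiv ℝ u x‖ ^ 2) +
            (∫ x : EuclideanSpace ℝ (Fin N), V x * u x ^ 2) + lam * c =
          ∫ x : EuclideanSpace ℝ (Fin N), g (u x) * u x) →
        ((((N : ℝ) - 2) / (2 * (N : ℝ))) *
              (∫ x : EuclideanSpace ℝ (Fin N), ‖fderiv ℝ u x‖ ^ 2) +
            (1 / (2 * (N : ℝ))) * (∫ x : EuclideanSpace ℝ (Fin N), Vt x * u x ^ 2) +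
            (1 / 2) * (∫ x : EuclideanSpace ℝ (Fin N), V x * u x ^ 2) + (lam / 2) * c =
          ∫ x : EuclideanSpace ℝ (Fin N), G (u x)) →
        0 < c → c < ctilde → 0 < lam := by
  have hNr : (3 : ℝ) ≤ N := by exact_mod_cast hN
  have hN0 : (0 : ℝ) < N := by linarith
  have hN2 : (0 : ℝ) < (N : ℝ) - 2 := by linarith
  have h4N : 0 < 4 / (N : ℝ) := by positivity
  have hβ2 : 2 < β := by linarith
  have hd2 : 2 < d := by linarith
  have hp : 0 < (2 * d - (N : ℝ) * (d - 2)) / 4 := by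
    rw [lt_div_iff₀ hN2] at hd'
    nlinarith
  have hq : 1 < (N : ℝ) * (d - 2) / 4 := by
    have : 4 / (N : ℝ) < d - 2 := by linarith
    rw [div_lt_iff₀ hN0] at this
    linarith
  have hδ : 0 < 1 - β * ((N : ℝ) - 2) / (2 * N) := by
    rw [lt_div_iff₀ hN2] at hβ'
    rw [sub_pos, div_lt_one (by positivity)]
    exact hβ'
  have hθ : 0 < 1 - nVhalf / (2 * S) := by
    rw [sub_pos, div_lt_one (by positivity)]
    exact hnVhalf
  set p := (2 * d - (N : ℝ) * (d - 2)) / 4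
  set q := (N : ℝ) * (d - 2) / 4
  set δ := 1 - β * ((N : ℝ) - 2) / (2 * N) with hδ_def
  have hβ1 : 0 < β / 2 - 1 := by linarith
  have hM : 0 ≤ (β / 2 - 1) * |nVinf| + β / (2 * N) * |nVtinf| := by positivity
  obtain ⟨ctilde, hct, hmain⟩ := exists_threshold_forall_mul_lt
    (D := N * (β / 2 - 1) * (C₂ * CNd)) hθ (by positivity) hp hq (div_nonneg hM hδ.le)
  refine ⟨ctilde, hct, ?_⟩
  intro g G α V Vt c lam u _ _ hG _ _ hAR hGd hV hVt hVti hVtn hVb hVtb hu _ huc hu2 hA0 hDu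
    hu2s hVu hVtu hgu hGu hSob hpoh hpoh' hc hcc
  have hVtc : Continuous Vt := by
    rw [funext hVt]
    exact (hV.continuous_fderiv one_ne_zero).clm_apply continuous_id
  have hud := integrable_abs_rpow_of_le_of_le hu.continuous hd2.le hd'.le hu2 hu2s
  have hGN' := hGN u hu hud hu2 hDu
  have hHol := integral_mul_sq_le_holder hVtc hu.continuous (by linarith) hVti hu2s hVtu
  have hB := abs_integral_mul_sq_le hVb hu2
  have hW := abs_integral_mul_sq_le hVtb hu2
  rw [huc] at hB hW hGN'
  rw [hVtn] at hHol
  have hnV0 : 0 ≤ nVhalf := by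
    rw [← hVtn]
    exact Real.rpow_nonneg (integral_nonneg fun x => Real.rpow_nonneg (le_max_right _ _) _) _
  have hK : ∫ x, g (u x) * u x ≤ β * ∫ x, G (u x) := by
    rw [← integral_const_mul]
    refine integral_mono hgu (hGu.const_mul β) fun x => ?_
    by_cases h : u x = 0
    · simp [h, hG]
    · exact (hAR _ h).2.2
  have hH : ∫ x, G (u x) ≤ C₂ * ∫ x, |u x| ^ d := by
    rw [← integral_const_mul]
    exact integral_mono hGu (hud.const_mul C₂) fun x => hGd _
  set A := ∫ x, ‖fderiv ℝ u x‖ ^ 2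
  set B := ∫ x, V x * u x ^ 2
  set W := ∫ x, Vt x * u x ^ 2
  set H := ∫ x, G (u x)
  set K := ∫ x, g (u x) * u x
  have hWA : W ≤ nVhalf / S * A := by
    refine hHol.trans ?_
    rw [show nVhalf / S * A = nVhalf * (A / S) by ring]
    refine mul_le_mul_of_nonneg_left ?_ hnV0
    rwa [le_div_iff₀ hS, mul_comm]
  have hAW : A - W / 2 = N * (K / 2 - H) := by
    rw [← hpoh, ← hpoh']
    field_simp
    ring
  have hlow : (1 - nVhalf / (2 * S)) * A ≤ N * (β / 2 - 1) * (C₂ * CNd) * c ^ p * A ^ q := by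
    have h1 : H ≤ C₂ * (CNd * c ^ p * A ^ q) := hH.trans (by gcongr)
    calc (1 - nVhalf / (2 * S)) * A = A - nVhalf / S * A / 2 := by field_simp
      _ ≤ A - W / 2 := by linarith
      _ = N * (K / 2 - H) := hAW
      _ ≤ N * ((β / 2 - 1) * H) := by gcongr; linarith
      _ ≤ N * ((β / 2 - 1) * (C₂ * (CNd * c ^ p * A ^ q))) := by gcongr
      _ = _ := by ring
  have hAc := hmain c A hc hcc hA0 hlow
  rw [div_mul_eq_mul_div, div_lt_iff₀ hδ] at hAc
  have hBc : B ≤ |nVinf| * c :=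
    (le_abs_self _).trans (hB.trans (mul_le_mul_of_nonneg_right (le_abs_self _) hc.le))
  have hWc : W ≤ |nVtinf| * c :=
    (le_abs_self _).trans (hW.trans (mul_le_mul_of_nonneg_right (le_abs_self _) hc.le))
  have hlam : A * δ - (β / 2 - 1) * B - β / (2 * N) * W ≤ (β / 2 - 1) * (lam * c) := by
    rw [← hpoh, ← hpoh'] at hK
    have e : A * δ - (β / 2 - 1) * B - β / (2 * N) * W - (β / 2 - 1) * (lam * c) =
        (A + B + lam * c) - β * (((N : ℝ) - 2) / (2 * N) * A + 1 / (2 * N) * W + 1 / 2 * B +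
          lam / 2 * c) := by
      rw [hδ_def]
      ring
    linarith
  have hB' := mul_le_mul_of_nonneg_left hBc hβ1.le
  have hW' := mul_le_mul_of_nonneg_left hWc (show 0 ≤ β / (2 * (N : ℝ)) by positivity)
  have hpos : 0 < (β / 2 - 1) * (lam * c) := by linarith
  exact pos_of_mul_pos_left (pos_of_mul_pos_right hpos hβ1.le) hc.le
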